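/- arXiv:2604.15179 — 7 statements merged into one kernel-verified Lean document; each statement's English description precedes it below -/
import Mathlib

section
/- Let E be a finite nonempty type and let P : E → E → ℝ be a Markov kernel (P x y ≥ 0 and ∑_y P x y = 1 for every x). Regard P as a complex matrix and suppose that 1 is a root of its characteristic polynomial of multiplicity exactly one and that every complex eigenvalue μ ≠ 1 of P satisfies |μ| < 1. Then there exists a function π : E → ℝ such that for all x, y ∈ E the matrix powers satisfy (P^t) x y → π y as t → ∞. -/
open Filter Topology Matrix

/-- A perturbed linear contraction `a (t + 1) = μ • a t + w t` with `‖μ‖ < 1` and vanishing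
perturbation `w` converges to `0`. -/
theorem tendsto_zero_of_contraction_recurrence {V : Type*} [NormedAddCommGroup V]
    [NormedSpace ℂ V] {μ : ℂ} (hμ : ‖μ‖ < 1) {a w : ℕ → V}
    (h : ∀ t, a (t + 1) = μ • a t + w t) (hw : Tendsto w atTop (𝓝 0)) :
    Tendsto a atTop (𝓝 0) := by
  rw [Metric.tendsto_atTop] at hw ⊢
  intro ε hε
  obtain ⟨N, hN⟩ := hw (ε / 2 * (1 - ‖μ‖)) (mul_pos (half_pos hε) (sub_pos.2 hμ))
  have hbound : ∀ s, ‖a (N + s)‖ ≤ ‖μ‖ ^ s * ‖a N‖ + ε / 2 := by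
    intro s
    induction s with
    | zero => simpa using (half_pos hε).le
    | succ s ih =>
      have hws := hN (N + s) (Nat.le_add_right N s)
      rw [dist_zero_right] at hws
      calc ‖a (N + (s + 1))‖ ≤ ‖μ‖ * ‖a (N + s)‖ + ‖w (N + s)‖ := by
            rw [← add_assoc, h, ← norm_smul]
            exact norm_add_le _ _
        _ ≤ ‖μ‖ * (‖μ‖ ^ s * ‖a N‖ + ε / 2) + ε / 2 * (1 - ‖μ‖) := by gcongr
        _ = ‖μ‖ ^ (s + 1) * ‖a N‖ + ε / 2 := by ring
  have hpow : Tendsto (fun s : ℕ => ‖μ‖ ^ s * ‖a N‖) atTop (𝓝 0) := by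
    simpa using (tendsto_pow_atTop_nhds_zero_of_lt_one (norm_nonneg μ) hμ).mul_const ‖a N‖
  obtain ⟨S, hS⟩ := eventually_atTop.1 (hpow.eventually_lt_const (half_pos hε))
  refine ⟨N + S, fun t ht => ?_⟩
  obtain ⟨s, rfl⟩ := Nat.exists_eq_add_of_le ((Nat.le_add_right N S).trans ht)
  rw [dist_zero_right]
  linarith [hbound s, hS s (by omega)]

/-- The powers of an endomorphism tend to `0` on a generalized eigenspace whose eigenvalue lies
in the open unit disc. -/
theorem tendsto_pow_apply_zero_of_mem_maxGenEigenspace {V : Type*} [NormedAddCommGroup V]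
    [NormedSpace ℂ V] (f : Module.End ℂ V) {μ : ℂ} (hμ : ‖μ‖ < 1) {v : V}
    (hv : v ∈ f.maxGenEigenspace μ) :
    Tendsto (fun t : ℕ => (f ^ t) v) atTop (𝓝 0) := by
  obtain ⟨k, hk⟩ := (Module.End.mem_maxGenEigenspace _ _ _).1 hv
  clear hv
  induction k generalizing v with
  | zero =>
    have hv : v = 0 := by simpa using hk
    simp [hv]
  | succ k ih =>
    rw [pow_succ, Module.End.mul_apply] at hk
    refine tendsto_zero_of_contraction_recurrence hμ (fun t => ?_) (ih hk)
    simp [pow_succ, Module.End.mul_apply]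

/-- If `f` fixes the constant vector `1`, its eigenvalue `1` is simple and all others lie in the
open unit disc, then the powers of `f`, applied to any vector, converge to a constant vector. -/
theorem exists_tendsto_pow_apply_const {E : Type*} [Fintype E] [Nonempty E]
    (f : Module.End ℂ (E → ℂ)) (hone : f 1 = 1)
    (hmult : f.charpoly.rootMultiplicity 1 = 1)
    (hspec : ∀ μ ∈ spectrum ℂ f, μ ≠ 1 → ‖μ‖ < 1) (v : E → ℂ) :
    ∃ c : ℂ, Tendsto (fun t : ℕ => (f ^ t) v) atTop (𝓝 (c • 1)) := by
  have hv : v ∈ ⨆ μ, f.maxGenEigenspace μ := by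
    rw [Module.End.iSup_maxGenEigenspace_eq_top]
    trivial
  induction hv using Submodule.iSup_induction' with
  | mem μ v hv =>
    by_cases hμ : μ = 1
    · subst hμ
      have hmem : (1 : E → ℂ) ∈ f.maxGenEigenspace 1 :=
        (Module.End.mem_maxGenEigenspace _ _ _).2 ⟨1, by simp [hone]⟩
      have hrank : Module.finrank ℂ (f.maxGenEigenspace 1) = 1 := by
        rw [f.finrank_maxGenEigenspace_eq, hmult]
      obtain ⟨c, hc⟩ := (finrank_eq_one_iff_of_nonzero' (⟨1, hmem⟩ : f.maxGenEigenspace 1)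
        (by simp [Subtype.ext_iff])).1 hrank ⟨v, hv⟩
      have hcv : c • (1 : E → ℂ) = v := congrArg Subtype.val hc
      have hpow (t : ℕ) : (f ^ t) 1 = 1 := by
        rw [Module.End.pow_apply]
        exact Function.iterate_fixed hone t
      refine ⟨c, ?_⟩
      simp [← hcv, hpow]
    · refine ⟨0, ?_⟩
      rw [zero_smul]
      rcases eq_or_ne v 0 with rfl | hv0
      · simp
      · have hgen : f.HasUnifEigenvalue μ ⊤ := (Submodule.ne_bot_iff _).2 ⟨v, hv, hv0⟩
        have hev : f.HasEigenvalue μ := hgen.lt zero_lt_one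
        exact tendsto_pow_apply_zero_of_mem_maxGenEigenspace f (hspec μ hev.mem_spectrum hμ) hv
  | zero => exact ⟨0, by simp⟩
  | add v w _ _ hv hw =>
    obtain ⟨c, hc⟩ := hv
    obtain ⟨d, hd⟩ := hw
    exact ⟨c + d, by simpa [add_smul] using hc.add hd⟩

/-- If a Markov kernel `P` on a finite nonempty state space, regarded as a complex
matrix, has `1` as a root of its characteristic polynomial of multiplicity exactly one and
all other complex eigenvalues of modulus strictly less than one, then the matrix powers
`P^t` converge entrywise to a function `π` of the column index. -/
theorem markov_kernel_powers_converge
    {E : Type*} [Fintype E] [Nonempty E] [DecidableEq E]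
    (P : Matrix E E ℝ)
    (hnonneg : ∀ x y, 0 ≤ P x y)
    (hrow : ∀ x, ∑ y, P x y = 1)
    (hmult : (Matrix.charpoly (P.map Complex.ofReal)).rootMultiplicity 1 = 1)
    (hspec : ∀ μ ∈ spectrum ℂ (P.map Complex.ofReal), μ ≠ 1 → ‖μ‖ < 1) :
    ∃ π : E → ℝ, ∀ x y, Tendsto (fun t : ℕ => (P ^ t) x y) atTop (𝓝 (π y)) := by
  set A : Matrix E E ℂ := P.map Complex.ofReal with hA
  have hone : toLin' A 1 = 1 := by
    ext x
    simp [hA, mulVec, dotProduct, ← Complex.ofReal_sum, hrow]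
  choose c hc using exists_tendsto_pow_apply_const (toLin' A) hone
    (by rwa [Matrix.charpoly_toLin']) (by rwa [Matrix.spectrum_toLin'])
  refine ⟨fun y => (c (Pi.single y 1)).re, fun x y => ?_⟩
  have hentry (t : ℕ) : (P ^ t) x y = ((toLin' A ^ t) (Pi.single y 1) x).re := by
    have hpow : A ^ t = (P ^ t).map Complex.ofReal := (Matrix.map_pow P Complex.ofRealHom t).symm
    rw [← Matrix.toLin'_pow, hpow]
    simp
  have hlim := (Complex.continuous_re.tendsto _).comp
    (tendsto_pi_nhds.1 (hc (Pi.single y 1)) x)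
  simpa [Function.comp_def, ← hentry] using hlim
end

section
/- Let E be a finite nonempty type, π : E → ℝ a strictly positive probability distribution, and T a proposal kernel on E. Then the Metropolis-Hastings kernel P is reversible with respect to π: for all x, y ∈ E, π x * P x y = π y * P y x. -/
theorem mul_min_one_div {a b : ℝ} (ha : 0 ≤ a) (hb : 0 ≤ b) :
    a * min 1 (b / a) = min a b := by
  rcases ha.eq_or_lt with rfl | ha
  · simp [hb]
  · rw [mul_min_of_nonneg _ _ ha.le, mul_one, mul_div_cancel₀ _ ha.ne']

/-- The Metropolis–Hastings kernel `P` built from a strictly positive target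
distribution `π` and a proposal kernel `T` is reversible with respect to `π`. -/
theorem metropolis_hastings_reversible
    {E : Type*} [Fintype E] [Nonempty E] [DecidableEq E]
    (π : E → ℝ) (hπpos : ∀ x, 0 < π x) (hπsum : ∑ x, π x = 1)
    (T : E → E → ℝ) (hTnn : ∀ x y, 0 ≤ T x y) (hTrow : ∀ x, ∑ y, T x y = 1)
    (hTdiag : ∀ x, T x x = 0)
    (A : E → E → ℝ)
    (hA : ∀ x y, A x y = min 1 ((π y * T y x) / (π x * T x y)))
    (P : E → E → ℝ)
    (hPoff : ∀ x y, x ≠ y → P x y = T x y * A x y)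
    (hPdiag : ∀ x, P x x = 1 - ∑ z ∈ Finset.univ.erase x, T x z * A x z) :
    ∀ x y, π x * P x y = π y * P y x := by
  intro x y
  rcases eq_or_ne x y with rfl | hxy
  · rfl
  have hnn : ∀ u v, 0 ≤ π u * T u v := fun u v => mul_nonneg (hπpos u).le (hTnn u v)
  rw [hPoff x y hxy, hPoff y x hxy.symm, hA, hA, ← mul_assoc, ← mul_assoc,
    mul_min_one_div (hnn x y) (hnn y x), mul_min_one_div (hnn y x) (hnn x y), min_comm]
end

section
/- Let E be a finite nonempty type, π : E → ℝ a strictly positive probability distribution, and T a proposal kernel on E. Then the dual acceptance kernel 𝒜, built from the Metropolis-Hastings acceptance function A, is reversible with respect to the dual stationary distribution ν: for all edges e, e' ∈ E × E, ν e * 𝒜 (e, e') = ν e' * 𝒜 (e', e). -/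
/-- The dual acceptance kernel `𝒜`, built from the Metropolis–Hastings acceptance
function `A`, is reversible with respect to the dual stationary distribution
`ν (x,y) = π x * T x y`. -/
theorem dual_acceptance_reversible
    {E : Type*} [Fintype E] [Nonempty E] [DecidableEq E]
    (π : E → ℝ) (hπpos : ∀ x, 0 < π x) (hπsum : ∑ x, π x = 1)
    (T : E → E → ℝ) (hTnn : ∀ x y, 0 ≤ T x y) (hTrow : ∀ x, ∑ y, T x y = 1)
    (hTdiag : ∀ x, T x x = 0)
    (A : E → E → ℝ)
    (hA : ∀ x y, A x y = min 1 ((π y * T y x) / (π x * T x y)))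
    (ν : E × E → ℝ) (hν : ∀ x y, ν (x, y) = π x * T x y)
    (Adual : E × E → E × E → ℝ)
    (hAdual : ∀ x y z t, Adual (x, y) (z, t) =
      if (z, t) = (y, x) then A x y else if (z, t) = (x, y) then 1 - A x y else 0) :
    ∀ e e' : E × E, ν e * Adual e e' = ν e' * Adual e' e := by
  have hw (x y : E) : 0 ≤ π x * T x y := mul_nonneg (hπpos x).le (hTnn x y)
  have balance (x y : E) : π x * T x y * A x y = π y * T y x * A y x := by
    rw [hA, hA, mul_min_one_div (hw x y) (hw y x), mul_min_one_div (hw y x) (hw x y), min_comm]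
  rintro ⟨x, y⟩ ⟨z, t⟩
  by_cases hswap : (z, t) = (y, x)
  · obtain ⟨rfl, rfl⟩ := Prod.mk.inj hswap
    rw [hν, hν, hAdual, hAdual, if_pos rfl, if_pos rfl, balance]
  by_cases hself : (z, t) = (x, y)
  · rw [hself]
  have hswap' : (x, y) ≠ (t, z) := fun h => hswap (congrArg Prod.swap h).symm
  rw [hAdual, hAdual, if_neg hswap, if_neg hself, if_neg hswap', if_neg (Ne.symm hself),
    mul_zero, mul_zero]
end

section
/- Let E be a finite nonempty type, π : E → ℝ a strictly positive probability distribution, and T a proposal kernel on E. Then the dual stationary distribution ν is stationary for the dual Metropolis-Hastings kernel 𝒫 = 𝒯𝒜: for every e' ∈ E × E, ∑_{e ∈ E×E} ν e * 𝒫 (e, e') = ν e'. -/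
/-- Detailed balance for the Metropolis–Hastings acceptance function. -/
theorem mul_min_one_div_comm {a b : ℝ} (ha : 0 ≤ a) (hb : 0 ≤ b) :
    a * min 1 (b / a) = b * min 1 (a / b) := by
  rcases ha.eq_or_lt with rfl | ha'
  · simp
  rcases hb.eq_or_lt with rfl | hb'
  · simp
  rw [mul_min_of_nonneg _ _ ha, mul_min_of_nonneg _ _ hb, mul_div_cancel₀ _ ha'.ne',
    mul_div_cancel₀ _ hb'.ne', mul_one, mul_one, min_comm]

/-- The dual stationary distribution `ν` is stationary for the dual
Metropolis–Hastings kernel `𝒫 = 𝒯𝒜`. -/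
theorem dual_stationary_distribution_stationary
    {E : Type*} [Fintype E] [Nonempty E] [DecidableEq E]
    (π : E → ℝ) (hπpos : ∀ x, 0 < π x) (hπsum : ∑ x, π x = 1)
    (T : E → E → ℝ) (hTnn : ∀ x y, 0 ≤ T x y) (hTrow : ∀ x, ∑ y, T x y = 1)
    (hTdiag : ∀ x, T x x = 0)
    (A : E → E → ℝ)
    (hA : ∀ x y, A x y = min 1 ((π y * T y x) / (π x * T x y)))
    (ν : E × E → ℝ) (hν : ∀ x y, ν (x, y) = π x * T x y)
    (Tdual : E × E → E × E → ℝ)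
    (hTdual : ∀ x y z t, Tdual (x, y) (z, t) = if z = x then T x t else 0)
    (Adual : E × E → E × E → ℝ)
    (hAdual : ∀ x y z t, Adual (x, y) (z, t) =
      if (z, t) = (y, x) then A x y else if (z, t) = (x, y) then 1 - A x y else 0)
    (Pdual : E × E → E × E → ℝ)
    (hPdual : ∀ e e' : E × E, Pdual e e' = ∑ e'' : E × E, Tdual e e'' * Adual e'' e') :
    ∀ e' : E × E, ∑ e : E × E, ν e * Pdual e e' = ν e' := by
  have balance (x y : E) : ν (x, y) * A x y = ν (y, x) * A y x := by
    rw [hν, hν, hA, hA]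
    exact mul_min_one_div_comm (mul_nonneg (hπpos x).le (hTnn x y))
      (mul_nonneg (hπpos y).le (hTnn y x))
  have proposal_stationary (e' : E × E) : ∑ e, ν e * Tdual e e' = ν e' := by
    obtain ⟨z, t⟩ := e'
    simp only [Fintype.sum_prod_type, hν, hTdual, mul_ite, mul_zero]
    rw [Finset.sum_eq_single z (fun x _ hx => by simp [hx.symm]) (by simp)]
    simp only [if_true]
    rw [← Finset.sum_mul, ← Finset.mul_sum, hTrow, mul_one]
  have acceptance_stationary (e' : E × E) : ∑ e, ν e * Adual e e' = ν e' := by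
    obtain ⟨z, t⟩ := e'
    have split (e : E × E) : ν e * Adual e (z, t) =
        (if e = (t, z) then ν (z, t) * A z t else 0) +
          (if e = (z, t) then ν (z, t) * (1 - A z t) else 0) := by
      obtain ⟨x, y⟩ := e
      rw [hAdual]
      by_cases hzt : z = t
      · subst hzt
        have hzero : ν (z, z) = 0 := by rw [hν, hTdiag, mul_zero]
        by_cases h : x = z ∧ y = z
        · obtain ⟨rfl, rfl⟩ := h
          simp [hzero]
        · simp only [Prod.mk.injEq]
          grind
      · have := balance z t
        simp only [Prod.mk.injEq]
        grind
    simp_rw [split, Finset.sum_add_distrib, Finset.sum_ite_eq', Finset.mem_univ, if_true]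
    ring
  intro e'
  simp_rw [hPdual, Finset.mul_sum]
  rw [Finset.sum_comm]
  simp_rw [← mul_assoc, ← Finset.sum_mul, proposal_stationary]
  exact acceptance_stationary e'
end

section
/- Let E be a finite nonempty type, π : E → ℝ a strictly positive probability distribution, and T a proposal kernel on E. Then the dual Metropolis-Hastings kernel 𝒫 = 𝒯𝒜 acts on first marginals exactly as the classical Metropolis-Hastings kernel P: for all x, y, z ∈ E, ∑_{t ∈ E} 𝒫 ((x,y),(z,t)) = P x z. -/
/-- The dual Metropolis–Hastings kernel `𝒫 = 𝒯𝒜` acts on first marginals exactly as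
the classical Metropolis–Hastings kernel `P`. -/
theorem dual_kernel_first_marginal_action
    {E : Type*} [Fintype E] [Nonempty E] [DecidableEq E]
    (π : E → ℝ) (hπpos : ∀ x, 0 < π x) (hπsum : ∑ x, π x = 1)
    (T : E → E → ℝ) (hTnn : ∀ x y, 0 ≤ T x y) (hTrow : ∀ x, ∑ y, T x y = 1)
    (hTdiag : ∀ x, T x x = 0)
    (A : E → E → ℝ)
    (hA : ∀ x y, A x y = min 1 ((π y * T y x) / (π x * T x y)))
    (P : E → E → ℝ)
    (hPoff : ∀ x y, x ≠ y → P x y = T x y * A x y)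
    (hPdiag : ∀ x, P x x = 1 - ∑ z ∈ Finset.univ.erase x, T x z * A x z)
    (Tdual : E × E → E × E → ℝ)
    (hTdual : ∀ x y z t, Tdual (x, y) (z, t) = if z = x then T x t else 0)
    (Adual : E × E → E × E → ℝ)
    (hAdual : ∀ x y z t, Adual (x, y) (z, t) =
      if (z, t) = (y, x) then A x y else if (z, t) = (x, y) then 1 - A x y else 0)
    (Pdual : E × E → E × E → ℝ)
    (hPdual : ∀ e e' : E × E, Pdual e e' = ∑ e'' : E × E, Tdual e e'' * Adual e'' e') :
    ∀ x y z : E, ∑ t, Pdual (x, y) (z, t) = P x z := by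
  intro x y z
  have sum_Adual : ∀ w, w ≠ x → ∑ t, Adual (x, w) (z, t) =
      (if z = w then A x w else 0) + (if z = x then 1 - A x w else 0) := by
    intro w hw
    simp only [hAdual, Prod.mk.injEq]
    by_cases hzw : z = w
    · subst hzw
      simp [hw]
    · by_cases hzx : z = x
      · subst hzx
        simp [hzw]
      · simp [hzw, hzx]
  have sum_Pdual : ∑ t, Pdual (x, y) (z, t) =
      ∑ w, T x w * ((if z = w then A x w else 0) + (if z = x then 1 - A x w else 0)) := by
    simp only [hPdual, Fintype.sum_prod_type, hTdual, ite_mul, zero_mul]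
    rw [Finset.sum_comm, Finset.sum_eq_single x (fun b _ hb => by simp [hb]) (by simp),
      Finset.sum_comm]
    refine Finset.sum_congr rfl fun w _ => ?_
    by_cases hw : w = x
    · simp [hw, hTdiag]
    · simp [← Finset.mul_sum, sum_Adual w hw]
  rw [sum_Pdual]
  by_cases hzx : z = x
  · subst hzx
    have row : ∑ w ∈ Finset.univ.erase z, T z w = 1 := by
      rw [Finset.sum_erase _ (hTdiag z), hTrow]
    rw [hPdiag, ← Finset.add_sum_erase _ _ (Finset.mem_univ z), hTdiag, zero_mul, zero_add]
    refine Eq.trans ?_ (congrArg (· - _) row)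
    rw [← Finset.sum_sub_distrib]
    refine Finset.sum_congr rfl fun w hw => ?_
    simp only [if_neg (Finset.ne_of_mem_erase hw).symm, if_true]
    ring
  · simp [hzx, hPoff x z (Ne.symm hzx)]
end

section
/- Let U be an n × n complex matrix that is both unitary (Uᴴ·U = 1) and Hermitian (Uᴴ = U), and let B be an n × k complex matrix with orthonormal columns (Bᴴ·B = 1). Let x ∈ ℂᵏ be a unit vector (Euclidean norm 1), let v ∈ ℝ with −1 < v < 1, and suppose (Bᴴ·U·B).mulVec x = v • x. Set γ = arccos v and define the qubitized walk operator W = (2·B·Bᴴ − 1)·U. Then for each sign ε ∈ {+1, −1}, the vector u_ε = exp(ε·i·γ) • (B.mulVec x) − (U·B).mulVec x satisfies W.mulVec u_ε = exp(ε·i·γ) • u_ε, and moreover ‖u_ε‖ = √2 · sin γ, so u_ε ≠ 0. -/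
open Matrix

theorem star_mulVec_dotProduct_mulVec {m n p : Type*} [Fintype m] [Fintype n] [Fintype p]
    (M : Matrix m n ℂ) (N : Matrix m p ℂ) (x : n → ℂ) (y : p → ℂ) :
    star (M.mulVec x) ⬝ᵥ N.mulVec y = star x ⬝ᵥ (Mᴴ * N).mulVec y := by
  rw [star_mulVec, ← dotProduct_mulVec, mulVec_mulVec]

theorem star_dotProduct_self_eq_sum_norm_sq {n : Type*} [Fintype n] (x : n → ℂ) :
    star x ⬝ᵥ x = ((∑ i, ‖x i‖ ^ 2 : ℝ) : ℂ) := by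
  simp [dotProduct, Complex.conj_mul']

theorem exp_mul_I_add_star (θ : ℝ) :
    Complex.exp (θ * Complex.I) + star (Complex.exp (θ * Complex.I)) = 2 * (Real.cos θ : ℂ) := by
  rw [Complex.star_def, Complex.add_conj, Complex.exp_ofReal_mul_I_re]
  push_cast
  rfl

theorem star_exp_mul_I_mul_self (θ : ℝ) :
    star (Complex.exp (θ * Complex.I)) * Complex.exp (θ * Complex.I) = 1 := by
  rw [Complex.star_def, Complex.conj_mul', Complex.norm_exp_ofReal_mul_I]
  simp

/-- Eigenpairs of the qubitized walk operator `W = (2 B Bᴴ - 1) U` arising from an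
eigenvector `x` of `A = Bᴴ U B` with eigenvalue `v ∈ (-1,1)`: for each sign
`ε ∈ {+1,-1}` the vector `u = e^{ε i γ} B x - U B x` (with `γ = arccos v`) satisfies
`W u = e^{ε i γ} u` and `‖u‖ = √2 sin γ`, so `u ≠ 0`. -/
theorem qubitized_walk_eigenpairs {n k : ℕ}
    (U : Matrix (Fin n) (Fin n) ℂ) (hUu : Uᴴ * U = 1) (hUh : Uᴴ = U)
    (B : Matrix (Fin n) (Fin k) ℂ) (hB : Bᴴ * B = 1)
    (x : Fin k → ℂ) (hx : ∑ j, ‖x j‖ ^ 2 = 1)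
    (v : ℝ) (hv1 : -1 < v) (hv2 : v < 1)
    (hAx : (Bᴴ * U * B).mulVec x = (v : ℂ) • x)
    (γ : ℝ) (hγ : γ = Real.arccos v)
    (W : Matrix (Fin n) (Fin n) ℂ) (hW : W = (2 * (B * Bᴴ) - 1) * U) :
    ∀ ε : ℝ, (ε = 1 ∨ ε = -1) →
      ∀ u : Fin n → ℂ,
        u = Complex.exp ((ε * γ : ℝ) * Complex.I) • B.mulVec x - (U * B).mulVec x →
        W.mulVec u = Complex.exp ((ε * γ : ℝ) * Complex.I) • u ∧
        Real.sqrt (∑ i, ‖u i‖ ^ 2) = Real.sqrt 2 * Real.sin γ ∧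
        u ≠ 0 := by
  intro ε hε u hu
  have hcos : Real.cos (ε * γ) = v := by
    have hγv : Real.cos γ = v := by rw [hγ, Real.cos_arccos hv1.le hv2.le]
    rcases hε with rfl | rfl <;> simpa using hγv
  have hsin_pos : 0 < Real.sin γ :=
    Real.sin_pos_of_pos_of_lt_pi (hγ ▸ Real.arccos_pos.2 hv2)
      (hγ ▸ Real.arccos_lt_pi.2 hv1)
  have hsin : Real.sin γ ^ 2 = 1 - v ^ 2 := by
    rw [Real.sin_sq, hγ, Real.cos_arccos hv1.le hv2.le]
  have hadd := exp_mul_I_add_star (ε * γ)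
  have hmul := star_exp_mul_I_mul_self (ε * γ)
  rw [hcos] at hadd
  set z := Complex.exp ((ε * γ : ℝ) * Complex.I)
  have hUU : U * U = 1 := by simpa only [hUh] using hUu
  have hxx : star x ⬝ᵥ x = 1 := by
    rw [star_dotProduct_self_eq_sum_norm_sq, hx, Complex.ofReal_one]
  have hWB : W.mulVec (B.mulVec x) = (2 * v : ℂ) • B.mulVec x - (U * B).mulVec x := by
    have h : W * B = B * (2 * (Bᴴ * U * B)) - U * B := by
      rw [hW]
      simp only [two_mul, Matrix.sub_mul, Matrix.add_mul, Matrix.mul_add, Matrix.mul_assoc,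
        Matrix.one_mul]
    rw [mulVec_mulVec, h, sub_mulVec, ← mulVec_mulVec, two_mul, add_mulVec, hAx, ← add_smul,
      mulVec_smul, ← two_mul]
  have hWUB : W.mulVec ((U * B).mulVec x) = B.mulVec x := by
    have h : W * (U * B) = B := by
      rw [hW, Matrix.mul_assoc, ← Matrix.mul_assoc U, hUU, Matrix.one_mul, Matrix.sub_mul,
        two_mul, Matrix.add_mul, Matrix.mul_assoc, hB]
      simp
    rw [mulVec_mulVec, h]
  have hsum : ∑ i, ‖u i‖ ^ 2 = 2 * Real.sin γ ^ 2 := by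
    have hUB : (U * B)ᴴ = Bᴴ * U := by rw [conjTranspose_mul, hUh]
    have hUBUB : Bᴴ * U * (U * B) = 1 := by
      rw [Matrix.mul_assoc, ← Matrix.mul_assoc U, hUU, Matrix.one_mul, hB]
    have h : star u ⬝ᵥ u = 2 * (1 - (v : ℂ) ^ 2) := by
      rw [hu]
      simp only [star_sub, star_smul, sub_dotProduct, dotProduct_sub, smul_dotProduct,
        dotProduct_smul, star_mulVec_dotProduct_mulVec, hUB, hUBUB, hB, ← Matrix.mul_assoc Bᴴ U B,
        hAx, one_mulVec, hxx, smul_eq_mul]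
      linear_combination hmul - (v : ℂ) * hadd
    rw [star_dotProduct_self_eq_sum_norm_sq] at h
    rw [hsin]
    exact_mod_cast h
  refine ⟨?_, ?_, ?_⟩
  · rw [hu, mulVec_sub, mulVec_smul, hWB, hWUB]
    ext i
    simp only [Pi.sub_apply, Pi.smul_apply, smul_eq_mul]
    linear_combination (hmul - z * hadd) * (B.mulVec x) i
  · rw [hsum, Real.sqrt_mul zero_le_two, Real.sqrt_sq hsin_pos.le]
  · rintro rfl
    simp only [Pi.zero_apply, norm_zero] at hsum
    norm_num at hsum
    exact hsin_pos.ne' hsum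
end

section
/- Let U be an n × n complex matrix that is both unitary (Uᴴ·U = 1) and Hermitian (Uᴴ = U), and let B be an n × k complex matrix with orthonormal columns (Bᴴ·B = 1). Let x ∈ ℂᵏ be a nonzero vector, let v ∈ {1, −1}, and suppose (Bᴴ·U·B).mulVec x = v • x. Then B.mulVec x is an eigenvector of the qubitized walk operator W = (2·B·Bᴴ − 1)·U with eigenvalue v: W.mulVec (B.mulVec x) = v • (B.mulVec x). -/
open Matrix

/-- A matrix with orthonormal columns is injective on vectors. -/
theorem mulVec_ne_zero_of_conjTranspose_mul_self_eq_one {n k : ℕ}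
    {B : Matrix (Fin n) (Fin k) ℂ} (hB : Bᴴ * B = 1) {x : Fin k → ℂ} (hx : x ≠ 0) :
    B.mulVec x ≠ 0 := fun h => hx <| by
  rw [← one_mulVec x, ← hB, ← mulVec_mulVec, h, mulVec_zero]

open scoped ComplexOrder in
/-- An eigenvector of the compression `Bᴴ U B` of a Hermitian unitary `U` with eigenvalue
`v = ±1` is mapped by `B` into the `v`-eigenspace of `U`. -/
theorem mulVec_mulVec_eq_smul_of_compression {n k : ℕ}
    {U : Matrix (Fin n) (Fin n) ℂ} (hUu : Uᴴ * U = 1) (hUh : Uᴴ = U)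
    {B : Matrix (Fin n) (Fin k) ℂ} (hB : Bᴴ * B = 1) {x : Fin k → ℂ}
    {v : ℂ} (hv : v = 1 ∨ v = -1) (hAx : (Bᴴ * U * B).mulVec x = v • x) :
    U.mulVec (B.mulVec x) = v • B.mulVec x := by
  have hvv : v * v = 1 := by rcases hv with rfl | rfl <;> norm_num
  have hvs : star v = v := by rcases hv with rfl | rfl <;> simp
  have hUU : U * U = 1 := by rwa [hUh] at hUu
  have hgram : (U * B - v • B)ᴴ * (U * B - v • B) =
      (2 : ℂ) • (1 : Matrix (Fin k) (Fin k) ℂ) - (2 * v) • (Bᴴ * U * B) := by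
    have hUUB : Bᴴ * U * (U * B) = 1 := by
      rw [Matrix.mul_assoc, ← Matrix.mul_assoc U, hUU, Matrix.one_mul, hB]
    simp only [conjTranspose_sub, conjTranspose_mul, conjTranspose_smul, hUh, hvs,
      Matrix.sub_mul, Matrix.mul_sub, Matrix.smul_mul, Matrix.mul_smul, hUUB, hB,
      smul_sub, smul_smul, hvv, ← Matrix.mul_assoc Bᴴ U B]
    module
  have hzero : (U * B - v • B).mulVec x = 0 := by
    rw [← conjTranspose_mul_self_mulVec_eq_zero, hgram, sub_mulVec, smul_mulVec, smul_mulVec,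
      hAx, one_mulVec, smul_smul, mul_assoc, hvv, mul_one, sub_self]
  rwa [sub_mulVec, smul_mulVec, ← mulVec_mulVec, sub_eq_zero] at hzero

/-- The reflection about the range of a matrix `B` with orthonormal columns fixes that range. -/
theorem reflection_mulVec_mulVec {n k : ℕ}
    {B : Matrix (Fin n) (Fin k) ℂ} (hB : Bᴴ * B = 1) (x : Fin k → ℂ) :
    (2 * (B * Bᴴ) - 1).mulVec (B.mulVec x) = B.mulVec x := by
  rw [mulVec_mulVec, Matrix.sub_mul, Matrix.mul_assoc, Matrix.mul_assoc, hB, Matrix.mul_one,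
    Matrix.one_mul, ← one_add_one_eq_two, Matrix.add_mul, Matrix.one_mul, add_sub_cancel_right]

/-- If `x` is a nonzero eigenvector of `A = Bᴴ U B` with eigenvalue `v ∈ {1, -1}`,
then `B x` is an eigenvector of the qubitized walk operator `W = (2 B Bᴴ - 1) U`
with eigenvalue `v`. -/
theorem qubitized_walk_boundary_eigenvector {n k : ℕ}
    (U : Matrix (Fin n) (Fin n) ℂ) (hUu : Uᴴ * U = 1) (hUh : Uᴴ = U)
    (B : Matrix (Fin n) (Fin k) ℂ) (hB : Bᴴ * B = 1)
    (x : Fin k → ℂ) (hx : x ≠ 0)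
    (v : ℂ) (hv : v = 1 ∨ v = -1)
    (hAx : (Bᴴ * U * B).mulVec x = v • x)
    (W : Matrix (Fin n) (Fin n) ℂ) (hW : W = (2 * (B * Bᴴ) - 1) * U) :
    B.mulVec x ≠ 0 ∧ W.mulVec (B.mulVec x) = v • B.mulVec x := by
  refine ⟨mulVec_ne_zero_of_conjTranspose_mul_self_eq_one hB hx, ?_⟩
  rw [hW, ← mulVec_mulVec, mulVec_mulVec_eq_smul_of_compression hUu hUh hB hv hAx, mulVec_smul,
    reflection_mulVec_mulVec hB]
end
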